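/- Let A be a collection of even-sized subsets of an n-element set with |A| ≥ 2^⌊n/2⌋ + 1. Then the number of distinct pairs {A,B} of sets from A with |A ∩ B| odd is at least 2^(⌊n/2⌋−1). -/

import Mathlib

/-- number of ordered pairs with odd intersection -/
def opE {n : ℕ} (S : Finset (Finset (Fin n))) : ℕ :=
  (S.offDiag.filter fun p => Odd ((p.1 ∩ p.2).card)).card

/-- characteristic vector -/
def chiV {n : ℕ} (A : Finset (Fin n)) : Fin n → ZMod 2 := fun i => if i ∈ A then 1 else 0

lemma chiV_inj {n : ℕ} : Function.Injective (chiV (n := n)) := by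
  intro A B h
  ext i
  have := congrFun h i
  unfold chiV at this
  by_cases h1 : i ∈ A <;> by_cases h2 : i ∈ B <;> simp_all

lemma chiV_dot {n : ℕ} (A B : Finset (Fin n)) :
    chiV A ⬝ᵥ chiV B = ((A ∩ B).card : ZMod 2) := by
  simp [dotProduct, chiV, Finset.inter_comm,
    ← ite_and, ← Finset.mem_inter]

lemma eventown_bound {n : ℕ} (I : Finset (Finset (Fin n)))
    (h : ∀ A ∈ I, ∀ B ∈ I, Even (A ∩ B).card) : I.card ≤ 2 ^ (n / 2) := by
  classical
  let B : LinearMap.BilinForm (ZMod 2) (Fin n → ZMod 2) := dotProductBilin (ZMod 2) (ZMod 2)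
  have hB : ∀ v w, B v w = v ⬝ᵥ w := fun v w => rfl
  have hsymm : B.IsSymm := ⟨fun v w => by simp [hB, dotProduct_comm]⟩
  have hnd : B.Nondegenerate := by
    refine ⟨fun v hv => dotProduct_eq_zero v hv, fun v hv => dotProduct_eq_zero v fun w => ?_⟩
    rw [dotProduct_comm]
    exact hv w
  let W : Submodule (ZMod 2) (Fin n → ZMod 2) := Submodule.span _ (chiV '' (I : Set _))
  have hW : W ≤ B.orthogonal W := by
    intro v hv w hw
    change B w v = 0
    induction hv, hw using Submodule.span_induction₂ with
    | mem_mem x y hx hy =>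
      obtain ⟨a, ha, rfl⟩ := hx
      obtain ⟨b, hb, rfl⟩ := hy
      rw [hB, chiV_dot]
      exact (ZMod.natCast_eq_zero_iff_even).2 (h b hb a ha)
    | zero_left => simp
    | zero_right => simp
    | add_left x y z _ _ _ h1 h2 => simp [h1, h2]
    | add_right x y z _ _ _ h1 h2 => simp [h1, h2]
    | smul_left r x y _ _ h1 => simp [h1]
    | smul_right r x y _ _ h1 => simp [h1]
  have h1 := Submodule.finrank_mono hW
  rw [LinearMap.BilinForm.finrank_orthogonal hnd] at h1
  simp only [Module.finrank_fintype_fun_eq_card, Fintype.card_fin] at h1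
  have h2 : I.card ≤ Nat.card W := by
    rw [← Set.ncard_coe_finset I, ← Set.ncard_image_of_injective _ chiV_inj]
    exact Set.ncard_le_ncard Submodule.subset_span (Set.toFinite _)
  have h3 : Nat.card W = 2 ^ Module.finrank (ZMod 2) W := by
    rw [Module.natCard_eq_pow_finrank (K := ZMod 2)]; simp
  have h4 := Submodule.finrank_le W
  rw [h3] at h2
  exact h2.trans (Nat.pow_le_pow_right (by norm_num) (by omega))

lemma symmDiff_parity {n : ℕ} (z x w : Finset (Fin n)) :
    Even ((symmDiff z x) ∩ w).card ↔ (Even (z ∩ w).card ↔ Even (x ∩ w).card) := by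
  have h : ((symmDiff z x) ∩ w).card + 2 * (z ∩ x ∩ w).card = (z ∩ w).card + (x ∩ w).card := by
    have e1 : (symmDiff z x) ∩ w = ((z ∩ w) \ (z ∩ x ∩ w)) ∪ ((x ∩ w) \ (z ∩ x ∩ w)) := by
      ext i; simp [Finset.mem_symmDiff]; tauto
    have d : Disjoint ((z ∩ w) \ (z ∩ x ∩ w)) ((x ∩ w) \ (z ∩ x ∩ w)) := by
      rw [Finset.disjoint_left]; intro i; simp; tauto
    have s1 : z ∩ x ∩ w ⊆ z ∩ w := by intro i; simp; tauto
    have s2 : z ∩ x ∩ w ⊆ x ∩ w := by intro i; simp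
    rw [e1, Finset.card_union_of_disjoint d]
    have := Finset.card_sdiff_add_card_eq_card s1
    have := Finset.card_sdiff_add_card_eq_card s2
    omega
  grind

lemma opE_insert {n : ℕ} (S : Finset (Finset (Fin n))) (u v : Finset (Fin n)) (hu : u ∉ S)
    (hv : v ∈ S) (h : Odd (u ∩ v).card) : opE S + 2 ≤ opE (insert u S) := by
  have huv : u ≠ v := by rintro rfl; exact hu hv
  unfold opE
  have hsub : (S.offDiag.filter fun p => Odd ((p.1 ∩ p.2).card)) ∪ {(u, v), (v, u)} ⊆
      ((insert u S).offDiag.filter fun p => Odd ((p.1 ∩ p.2).card)) := by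
    intro p hp
    simp only [Finset.mem_union, Finset.mem_filter, Finset.mem_offDiag, Finset.mem_insert,
      Finset.mem_singleton] at hp ⊢
    rcases hp with hp | rfl | rfl
    · tauto
    · simp [hv, huv, h]
    · simp [hv, huv.symm, Finset.inter_comm v u, h]
  have := Finset.card_le_card hsub
  rw [Finset.card_union_of_disjoint, Finset.card_pair] at this
  · exact this
  · simp [huv]
  · rw [Finset.disjoint_left]
    intro p hp hq
    simp only [Finset.mem_filter, Finset.mem_offDiag, Finset.mem_insert,
      Finset.mem_singleton] at hp hq
    rcases hq with rfl | rfl <;> tauto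

lemma opE_mono {n : ℕ} {S T : Finset (Finset (Fin n))} (h : S ⊆ T) : opE S ≤ opE T :=
  Finset.card_le_card (Finset.filter_subset_filter _ (Finset.offDiag_mono h))

lemma opE_union {n : ℕ} (T D : Finset (Finset (Fin n))) (hd : Disjoint T D)
    (h : ∀ u ∈ D, ∃ v ∈ T, Odd (u ∩ v).card) : opE T + 2 * D.card ≤ opE (T ∪ D) := by
  induction D using Finset.induction_on with
  | empty => simp
  | insert u D hu ih =>
    rw [Finset.disjoint_insert_right] at hd
    have := ih hd.2 (fun w hw => h w (Finset.mem_insert_of_mem hw))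
    obtain ⟨v, hv, ho⟩ := h u (Finset.mem_insert_self _ _)
    have h2 := opE_insert (T ∪ D) u v (by simp [hu, hd.1]) (by simp [hv]) ho
    rw [Finset.union_insert, Finset.card_insert_of_notMem hu]
    omega

lemma opE_alpha {n : ℕ} (α : ℕ) (S : Finset (Finset (Fin n)))
    (heven : ∀ A ∈ S, Even A.card)
    (h : ∀ I ⊆ S, (∀ A ∈ I, ∀ B ∈ I, Even (A ∩ B).card) → I.card ≤ α) :
    2 * S.card ≤ opE S + 2 * α := by
  induction S using Finset.strongInduction with
  | H S ih =>
    by_cases hS : ∀ A ∈ S, ∀ B ∈ S, Even (A ∩ B).card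
    · have := h S subset_rfl hS
      omega
    · push Not at hS
      obtain ⟨u, hu, v, hv, ho⟩ := hS
      have huv : v ≠ u := by
        rintro rfl
        rw [Finset.inter_self] at ho
        exact (Nat.not_even_iff_odd.2 (by simpa using ho)) (heven _ hu)
      have h1 := ih (S.erase u) (Finset.erase_ssubset hu)
        (fun A hA => heven A (Finset.mem_of_mem_erase hA))
        (fun I hI => h I (hI.trans (Finset.erase_subset _ _)))
      have h2 := opE_insert (S.erase u) u v (by simp) (by simp [hv, huv]) (by simpa using ho)
      rw [Finset.insert_erase hu] at h2
      have := Finset.card_erase_add_one hu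
      omega

/-- Eventown supersaturation, s = 1: a family of at least `2^⌊n/2⌋ + 1`
even-sized subsets of an `n`-element set has at least `2^(⌊n/2⌋ - 1)` unordered
pairs with odd-sized intersection.  (Counting ordered pairs via `offDiag`, the
bound is doubled.) -/
theorem eventown_supersat_one (n : ℕ) (𝒜 : Finset (Finset (Fin n)))
    (heven : ∀ A ∈ 𝒜, Even A.card)
    (hcard : 2 ^ (n / 2) + 1 ≤ 𝒜.card) :
    2 * 2 ^ (n / 2 - 1) ≤
      (𝒜.offDiag.filter fun p => Odd ((p.1 ∩ p.2).card)).card := by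
  change _ ≤ opE 𝒜
  have hS : ¬ ∀ A ∈ 𝒜, ∀ B ∈ 𝒜, Even (A ∩ B).card := fun hS => by
    have := eventown_bound 𝒜 hS
    omega
  push Not at hS
  obtain ⟨x, hx, y, hy, ho⟩ := hS
  replace ho : Odd (x ∩ y).card := by simpa using ho
  have hxy : x ≠ y := by
    rintro rfl
    rw [Finset.inter_self] at ho
    exact (Nat.not_even_iff_odd.2 ho) (heven _ hx)
  set Z := 𝒜.filter (fun z => Even (z ∩ x).card ∧ Even (z ∩ y).card) with hZ
  have hxZ : x ∉ Z := by
    simp only [hZ, Finset.mem_filter]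
    rintro ⟨_, _, h⟩
    exact (Nat.not_even_iff_odd.2 ho) h
  have hyZ : y ∉ Z := by
    simp only [hZ, Finset.mem_filter]
    rintro ⟨_, h, _⟩
    rw [Finset.inter_comm] at h
    exact (Nat.not_even_iff_odd.2 ho) h
  have hZA : Z ⊆ 𝒜 := Finset.filter_subset _ _
  have hα : 2 * Z.card ≤ opE Z + 2 * (2 ^ (n / 2) / 2) := by
    apply opE_alpha _ _ (fun A hA => heven A (hZA hA))
    intro I hI hIo
    have hinj : Function.Injective (fun z : Finset (Fin n) => symmDiff z x) :=
      symmDiff_left_injective x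
    have hIy : ∀ z ∈ I, Even (z ∩ y).card := fun z hz => (Finset.mem_filter.1 (hI hz)).2.2
    have hIx : ∀ z ∈ I, Even (z ∩ x).card := fun z hz => (Finset.mem_filter.1 (hI hz)).2.1
    have hxx : Even (x ∩ x).card := by simpa using heven x hx
    have hd : Disjoint I (I.image (fun z => symmDiff z x)) := by
      rw [Finset.disjoint_left]
      intro z hz hz'
      obtain ⟨w, hw, rfl⟩ := Finset.mem_image.1 hz'
      have h1 := hIy _ hz
      rw [symmDiff_parity] at h1
      exact (Nat.not_even_iff_odd.2 ho) (h1.1 (hIy w hw))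
    have hb := eventown_bound (I ∪ I.image (fun z => symmDiff z x)) (by
      have key : ∀ a ∈ I, ∀ w, (Even (a ∩ w).card ∧ Even (x ∩ w).card) →
          Even (symmDiff a x ∩ w).card := fun a _ w h => by
        rw [symmDiff_parity]; tauto
      have c1 : ∀ a ∈ I, ∀ b ∈ I, Even (symmDiff a x ∩ b).card := fun a ha b hb =>
        key a ha b ⟨hIo a ha b hb, by rw [Finset.inter_comm]; exact hIx b hb⟩
      have c2 : ∀ a ∈ I, Even (symmDiff a x ∩ x).card := fun a ha =>
        key a ha x ⟨hIx a ha, hxx⟩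
      intro A hA B hB
      simp only [Finset.mem_union, Finset.mem_image] at hA hB
      rcases hA with hA | ⟨a, ha, rfl⟩ <;> rcases hB with hB | ⟨b, hb, rfl⟩
      · exact hIo A hA B hB
      · rw [Finset.inter_comm]; exact c1 b hb A hA
      · exact c1 a ha B hB
      · refine key a ha _ ⟨?_, ?_⟩
        · rw [Finset.inter_comm]; exact c1 b hb a ha
        · rw [Finset.inter_comm]; exact c2 b hb)
    rw [Finset.card_union_of_disjoint hd, Finset.card_image_of_injective _ hinj] at hb
    omega
  have h1 : opE Z ≤ opE (insert x Z) := opE_mono (Finset.subset_insert _ _)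
  have h2 := opE_insert (insert x Z) y x (by simp [hyZ, hxy.symm]) (by simp)
    (by rwa [Finset.inter_comm])
  set T := insert y (insert x Z) with hT
  have hTA : T ⊆ 𝒜 := by
    simp only [hT, Finset.insert_subset_iff]
    exact ⟨hy, hx, hZA⟩
  have hTc : T.card = Z.card + 2 := by
    rw [hT, Finset.card_insert_of_notMem (by simp [hyZ, hxy.symm]),
      Finset.card_insert_of_notMem hxZ]
  have h3 := opE_union T (𝒜 \ T) Finset.disjoint_sdiff (by
    intro u hu
    simp only [Finset.mem_sdiff, hT, hZ, Finset.mem_insert, Finset.mem_filter, not_or] at hu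
    by_cases hux : Even (u ∩ x).card
    · refine ⟨y, by simp [hT], ?_⟩
      rw [← Nat.not_even_iff_odd]
      tauto
    · exact ⟨x, by simp [hT], Nat.not_even_iff_odd.1 hux⟩)
  rw [Finset.union_sdiff_of_subset hTA] at h3
  have h4 := Finset.card_sdiff_add_card_eq_card hTA
  have h5 : 2 ^ (n / 2 - 1) + 2 ^ (n / 2) / 2 ≤ 2 ^ (n / 2) := by
    rcases Nat.eq_zero_or_pos (n / 2) with h | h
    · simp [h]
    · obtain ⟨k, hk⟩ := Nat.exists_eq_add_of_lt h
      rw [hk]; simp [pow_succ]; omega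
  omega
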